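/- arXiv:2508.20968 — 2 statements merged into one kernel-verified Lean document; each statement's English description precedes it below -/
import Mathlib

section
/- Let U ⊆ ℝ² be an open set containing [0,1]², and let b = (b₁, b₂), σ₁ = (σ₁₁, σ₁₂), σ₂ = (σ₂₁, σ₂₂) be twice continuously differentiable vector fields U → ℝ² with b₂, σ₁₂, σ₂₂ vanishing on [0,1] × {0} and b₁, σ₁₁, σ₂₁ vanishing on {0} × [0,1]. For i ∈ {1,2} with i′ the other index and x ∈ (0,1)², define G_i(x) = b_i(x)/x_i + (1/2) Σ_{m=1}^{2} [ ∂_{i′}σ_{m i}(x) σ_{m i′}(x)/x_i + ∂_i σ_{m i}(x) σ_{m i}(x)/x_i − σ_{m i}(x)²/x_i² ]. Assume moreover that λ₁ = ∂₁b₁(0,0) ≠ 0 and λ₂ = ∂₂b₂(0,0) ≠ 0. Then there exists r ∈ (0, 1/4) such that for every x ∈ (0,1)² with x₁ + x₂ < r and for all real constants α, β: |α G₁(x) + β G₂(x) − (α λ₁ + β λ₂)| ≤ (1/2)|α||λ₁| + (1/2)|β||λ₂|. -/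
open Set

/-- First partial derivative `∂₁ f` of a function of two real variables. -/
noncomputable def pd1 (f : ℝ × ℝ → ℝ) (x : ℝ × ℝ) : ℝ := fderiv ℝ f x (1, 0)

/-- Second partial derivative `∂₂ f` of a function of two real variables. -/
noncomputable def pd2 (f : ℝ × ℝ → ℝ) (x : ℝ × ℝ) : ℝ := fderiv ℝ f x (0, 1)

/-- The value `G₁(x)` of the diffusion generator applied to `ln ∘ x₁`:
`G₁(x) = b₁(x)/x₁ + (1/2) Σ_m [∂₂σ_{m1}(x) σ_{m2}(x)/x₁ + ∂₁σ_{m1}(x) σ_{m1}(x)/x₁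
 − σ_{m1}(x)²/x₁²]`. -/
noncomputable def genLog1 (b1 s11 s12 s21 s22 : ℝ × ℝ → ℝ) (x : ℝ × ℝ) : ℝ :=
  b1 x / x.1 + (1 / 2) *
    ((pd2 s11 x * s12 x / x.1 + pd1 s11 x * s11 x / x.1 - s11 x ^ 2 / x.1 ^ 2)
      + (pd2 s21 x * s22 x / x.1 + pd1 s21 x * s21 x / x.1 - s21 x ^ 2 / x.1 ^ 2))

/-- The value `G₂(x)` of the diffusion generator applied to `ln ∘ x₂`:
`G₂(x) = b₂(x)/x₂ + (1/2) Σ_m [∂₁σ_{m2}(x) σ_{m1}(x)/x₂ + ∂₂σ_{m2}(x) σ_{m2}(x)/x₂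
 − σ_{m2}(x)²/x₂²]`. -/
noncomputable def genLog2 (b2 s11 s12 s21 s22 : ℝ × ℝ → ℝ) (x : ℝ × ℝ) : ℝ :=
  b2 x / x.2 + (1 / 2) *
    ((pd1 s12 x * s11 x / x.2 + pd2 s12 x * s12 x / x.2 - s12 x ^ 2 / x.2 ^ 2)
      + (pd1 s22 x * s21 x / x.2 + pd2 s22 x * s22 x / x.2 - s22 x ^ 2 / x.2 ^ 2))

open Filter Topology

/-- A function vanishing on the left edge, divided by `x₁`, tends to its `∂₁`-derivative at the
corner. -/
lemma tendsto_div_fst_of_hasStrictFDerivAt {f : ℝ × ℝ → ℝ} {f' : ℝ × ℝ →L[ℝ] ℝ}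
    (hf : HasStrictFDerivAt f f' (0, 0)) (h0 : ∀ t ∈ Ioo (0 : ℝ) 1, f (0, t) = 0) :
    Tendsto (fun x : ℝ × ℝ => f x / x.1) (𝓝[Ioo 0 1 ×ˢ Ioo 0 1] (0, 0)) (𝓝 (f' (1, 0))) := by
  rw [Metric.tendsto_nhds]
  intro ε hε
  have hp : Tendsto (fun x : ℝ × ℝ => (x, ((0 : ℝ), x.2)))
      (𝓝[Ioo 0 1 ×ˢ Ioo 0 1] (0, 0)) (𝓝 ((0, 0), (0, 0))) := by
    have hc : Continuous (fun x : ℝ × ℝ => (x, ((0 : ℝ), x.2))) := by fun_prop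
    exact (hc.tendsto' (0, 0) _ rfl).mono_left nhdsWithin_le_nhds
  filter_upwards [hp.eventually (hf.isLittleO.def (half_pos hε)), self_mem_nhdsWithin] with x hx hQ
  have hx1 : 0 < x.1 := hQ.1.1
  have hsub : x - (0, x.2) = x.1 • ((1 : ℝ), (0 : ℝ)) := by ext <;> simp
  rw [h0 _ hQ.2, sub_zero, hsub, map_smul, norm_smul] at hx
  have hn : ‖((1 : ℝ), (0 : ℝ))‖ = 1 := by simp [Prod.norm_def]
  rw [hn, Real.norm_eq_abs, Real.norm_eq_abs, abs_of_pos hx1, smul_eq_mul] at hx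
  have he : f x / x.1 - f' (1, 0) = (f x - x.1 * f' (1, 0)) / x.1 := by field_simp
  rw [Real.dist_eq, he, abs_div, abs_of_pos hx1, div_lt_iff₀ hx1]
  nlinarith

/-- The `∂₂`-derivative vanishes where the function vanishes along the left edge. -/
lemma pd2_left_edge_eq_zero {f : ℝ × ℝ → ℝ} (h0 : ∀ t ∈ Icc (0 : ℝ) 1, f (0, t) = 0)
    {t : ℝ} (ht : t ∈ Ioo (0 : ℝ) 1) (hf : DifferentiableAt ℝ f (0, t)) : pd2 f (0, t) = 0 := by
  have hc : HasDerivAt (fun s : ℝ => ((0 : ℝ), s)) (0, 1) t :=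
    (hasDerivAt_const t (0 : ℝ)).prodMk (hasDerivAt_id t)
  have h1 : HasDerivAt (fun s : ℝ => f (0, s)) (pd2 f (0, t)) t :=
    hf.hasFDerivAt.comp_hasDerivAt t hc
  refine h1.unique ((hasDerivAt_const t (0 : ℝ)).congr_of_eventuallyEq ?_)
  filter_upwards [isOpen_Ioo.mem_nhds ht] with s hs
  exact h0 s (Ioo_subset_Icc_self hs)

/-- `f(x) / x₁ → ∂₁ f(0,0)` for a smooth function vanishing on the left edge. -/
lemma tendsto_div_fst {U : Set (ℝ × ℝ)} (hU : IsOpen U) (hsq : Icc ((0 : ℝ), (0 : ℝ)) (1, 1) ⊆ U)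
    {f : ℝ × ℝ → ℝ} (hf : ContDiffOn ℝ 2 f U) (h0 : ∀ t ∈ Icc (0 : ℝ) 1, f (0, t) = 0) :
    Tendsto (fun x : ℝ × ℝ => f x / x.1) (𝓝[Ioo 0 1 ×ˢ Ioo 0 1] (0, 0)) (𝓝 (pd1 f (0, 0))) :=
  tendsto_div_fst_of_hasStrictFDerivAt
    ((hf.contDiffAt (hU.mem_nhds (hsq (by simp [Prod.le_def])))).hasStrictFDerivAt (by norm_num))
    fun t ht => h0 t (Ioo_subset_Icc_self ht)

/-- The Itô correction contributed by one noise field vanishes at the corner. -/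
lemma tendsto_ito_correction {U : Set (ℝ × ℝ)} (hU : IsOpen U)
    (hsq : Icc ((0 : ℝ), (0 : ℝ)) (1, 1) ⊆ U) {f g : ℝ × ℝ → ℝ}
    (hf : ContDiffOn ℝ 2 f U) (hg : ContDiffOn ℝ 2 g U)
    (h0 : ∀ t ∈ Icc (0 : ℝ) 1, f (0, t) = 0) (hg0 : g (0, 0) = 0) :
    Tendsto (fun x : ℝ × ℝ =>
      pd2 f x * g x / x.1 + pd1 f x * f x / x.1 - f x ^ 2 / x.1 ^ 2)
      (𝓝[Ioo 0 1 ×ˢ Ioo 0 1] (0, 0)) (𝓝 0) := by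
  have hO : U ∈ 𝓝 ((0 : ℝ), (0 : ℝ)) := hU.mem_nhds (hsq (by simp [Prod.le_def]))
  have hd : ContDiffAt ℝ 1 (fderiv ℝ f) (0, 0) :=
    (hf.contDiffAt hO).fderiv_right (by norm_num)
  have h1 : Tendsto (pd1 f) (𝓝[Ioo 0 1 ×ˢ Ioo 0 1] (0, 0)) (𝓝 (pd1 f (0, 0))) :=
    (hd.clm_apply contDiffAt_const).continuousAt.tendsto.mono_left nhdsWithin_le_nhds
  have h2 := tendsto_div_fst_of_hasStrictFDerivAt (f := pd2 f)
    ((hd.clm_apply contDiffAt_const).hasStrictFDerivAt (by norm_num))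
    fun t ht => pd2_left_edge_eq_zero h0 ht
      ((hf.contDiffAt (hU.mem_nhds (hsq (by simp [Prod.le_def, ht.1.le, ht.2.le])))).differentiableAt
        (by norm_num))
  have h3 : Tendsto g (𝓝[Ioo 0 1 ×ˢ Ioo 0 1] (0, 0)) (𝓝 0) := by
    have := (hg.contDiffAt hO).continuousAt.tendsto
    rw [hg0] at this
    exact this.mono_left nhdsWithin_le_nhds
  have h4 := tendsto_div_fst hU hsq hf h0
  have h := ((h2.mul h3).add (h1.mul h4)).sub (h4.pow 2)
  rw [mul_zero, zero_add, ← sq, sub_self] at h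
  exact h.congr fun x => by ring

lemma tendsto_genLog1 {U : Set (ℝ × ℝ)} (hU : IsOpen U)
    (hsq : Icc ((0 : ℝ), (0 : ℝ)) (1, 1) ⊆ U) {b1 s11 s12 s21 s22 : ℝ × ℝ → ℝ}
    (hb1 : ContDiffOn ℝ 2 b1 U)
    (hs11 : ContDiffOn ℝ 2 s11 U) (hs12 : ContDiffOn ℝ 2 s12 U)
    (hs21 : ContDiffOn ℝ 2 s21 U) (hs22 : ContDiffOn ℝ 2 s22 U)
    (hbot : s12 (0, 0) = 0 ∧ s22 (0, 0) = 0)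
    (hleft : ∀ t ∈ Icc (0 : ℝ) 1, b1 (0, t) = 0 ∧ s11 (0, t) = 0 ∧ s21 (0, t) = 0) :
    Tendsto (genLog1 b1 s11 s12 s21 s22) (𝓝[Ioo 0 1 ×ˢ Ioo 0 1] (0, 0))
      (𝓝 (pd1 b1 (0, 0))) := by
  have h := (tendsto_div_fst hU hsq hb1 fun t ht => (hleft t ht).1).add
    (((tendsto_ito_correction hU hsq hs11 hs12 (fun t ht => (hleft t ht).2.1) hbot.1).add
      (tendsto_ito_correction hU hsq hs21 hs22 (fun t ht => (hleft t ht).2.2) hbot.2)).const_mul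
        (1 / 2))
  rw [add_zero, mul_zero, add_zero] at h
  exact h

lemma pd1_comp_swap (f : ℝ × ℝ → ℝ) (x : ℝ × ℝ) : pd1 (f ∘ Prod.swap) x = pd2 f x.swap := by
  have h := (ContinuousLinearEquiv.prodComm ℝ ℝ ℝ).comp_right_fderiv (f := f) (x := x)
  exact DFunLike.congr_fun h (1, 0)

lemma pd2_comp_swap (f : ℝ × ℝ → ℝ) (x : ℝ × ℝ) : pd2 (f ∘ Prod.swap) x = pd1 f x.swap := by
  have h := (ContinuousLinearEquiv.prodComm ℝ ℝ ℝ).comp_right_fderiv (f := f) (x := x)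
  exact DFunLike.congr_fun h (0, 1)

lemma genLog1_comp_swap (b2 s11 s12 s21 s22 : ℝ × ℝ → ℝ) (x : ℝ × ℝ) :
    genLog1 (b2 ∘ Prod.swap) (s12 ∘ Prod.swap) (s11 ∘ Prod.swap) (s22 ∘ Prod.swap)
      (s21 ∘ Prod.swap) x.swap = genLog2 b2 s11 s12 s21 s22 x := by
  simp [genLog1, genLog2, pd1_comp_swap, pd2_comp_swap]

lemma tendsto_genLog2 {U : Set (ℝ × ℝ)} (hU : IsOpen U)
    (hsq : Icc ((0 : ℝ), (0 : ℝ)) (1, 1) ⊆ U) {b2 s11 s12 s21 s22 : ℝ × ℝ → ℝ}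
    (hb2 : ContDiffOn ℝ 2 b2 U)
    (hs11 : ContDiffOn ℝ 2 s11 U) (hs12 : ContDiffOn ℝ 2 s12 U)
    (hs21 : ContDiffOn ℝ 2 s21 U) (hs22 : ContDiffOn ℝ 2 s22 U)
    (hbot : ∀ t ∈ Icc (0 : ℝ) 1, b2 (t, 0) = 0 ∧ s12 (t, 0) = 0 ∧ s22 (t, 0) = 0)
    (hleft : s11 (0, 0) = 0 ∧ s21 (0, 0) = 0) :
    Tendsto (genLog2 b2 s11 s12 s21 s22) (𝓝[Ioo 0 1 ×ˢ Ioo 0 1] (0, 0))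
      (𝓝 (pd2 b2 (0, 0))) := by
  have hc : ∀ {f : ℝ × ℝ → ℝ}, ContDiffOn ℝ 2 f U →
      ContDiffOn ℝ 2 (f ∘ Prod.swap) (Prod.swap ⁻¹' U) := fun hf =>
    hf.comp (ContinuousLinearEquiv.prodComm ℝ ℝ ℝ).contDiff.contDiffOn fun _ hx => hx
  have h := tendsto_genLog1 (hU.preimage continuous_swap)
    (fun x hx => hsq ⟨⟨hx.1.2, hx.1.1⟩, ⟨hx.2.2, hx.2.1⟩⟩)
    (hc hb2) (hc hs12) (hc hs11) (hc hs22) (hc hs21) hleft hbot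
  rw [pd1_comp_swap] at h
  have hs : Tendsto Prod.swap (𝓝[Ioo 0 1 ×ˢ Ioo 0 1] ((0 : ℝ), (0 : ℝ)))
      (𝓝[Ioo 0 1 ×ˢ Ioo 0 1] (0, 0)) :=
    continuous_swap.continuousWithinAt.tendsto_nhdsWithin fun _ hx => ⟨hx.2, hx.1⟩
  exact (h.comp hs).congr fun x => genLog1_comp_swap b2 s11 s12 s21 s22 x

/-- Corollary 4.2 of the paper: under boundary hyperbolicity `λ₁, λ₂ ≠ 0` at the vertex
`(0,0)`, there is `r ∈ (0, 1/4)` such that for each `x` in the open unit square with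
`x₁ + x₂ < r` and all constants `α, β`:
`|α G₁(x) + β G₂(x) − (α λ₁ + β λ₂)| ≤ (1/2)|α||λ₁| + (1/2)|β||λ₂|`. -/
theorem generator_log_combination_near_corner
    (U : Set (ℝ × ℝ)) (hU : IsOpen U)
    (hsq : Set.Icc ((0 : ℝ), (0 : ℝ)) (1, 1) ⊆ U)
    (b1 b2 s11 s12 s21 s22 : ℝ × ℝ → ℝ)
    (hb1 : ContDiffOn ℝ 2 b1 U) (hb2 : ContDiffOn ℝ 2 b2 U)
    (hs11 : ContDiffOn ℝ 2 s11 U) (hs12 : ContDiffOn ℝ 2 s12 U)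
    (hs21 : ContDiffOn ℝ 2 s21 U) (hs22 : ContDiffOn ℝ 2 s22 U)
    (hbot : ∀ x₁ ∈ Set.Icc (0 : ℝ) 1,
      b2 (x₁, 0) = 0 ∧ s12 (x₁, 0) = 0 ∧ s22 (x₁, 0) = 0)
    (hleft : ∀ x₂ ∈ Set.Icc (0 : ℝ) 1,
      b1 (0, x₂) = 0 ∧ s11 (0, x₂) = 0 ∧ s21 (0, x₂) = 0)
    (hlam1 : pd1 b1 (0, 0) ≠ 0) (hlam2 : pd2 b2 (0, 0) ≠ 0) :
    ∃ r : ℝ, r ∈ Set.Ioo (0 : ℝ) (1 / 4) ∧ ∀ x : ℝ × ℝ,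
      x.1 ∈ Set.Ioo (0 : ℝ) 1 → x.2 ∈ Set.Ioo (0 : ℝ) 1 → x.1 + x.2 < r →
      ∀ α β : ℝ,
        |α * genLog1 b1 s11 s12 s21 s22 x + β * genLog2 b2 s11 s12 s21 s22 x
            - (α * pd1 b1 (0, 0) + β * pd2 b2 (0, 0))|
          ≤ (1 / 2) * |α| * |pd1 b1 (0, 0)| + (1 / 2) * |β| * |pd2 b2 (0, 0)| := by
  have hz : (0 : ℝ) ∈ Icc (0 : ℝ) 1 := by simp
  have h1 := tendsto_genLog1 hU hsq hb1 hs11 hs12 hs21 hs22 (hbot 0 hz).2 hleft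
  have h2 := tendsto_genLog2 hU hsq hb2 hs11 hs12 hs21 hs22 hbot (hleft 0 hz).2
  have e1 := Metric.tendsto_nhds.1 h1 _ (half_pos (abs_pos.2 hlam1))
  have e2 := Metric.tendsto_nhds.1 h2 _ (half_pos (abs_pos.2 hlam2))
  obtain ⟨ε, hε, hball⟩ := Metric.mem_nhdsWithin_iff.1 (e1.and e2)
  refine ⟨min ε (1 / 8), ⟨lt_min hε (by norm_num), (min_le_right _ _).trans_lt (by norm_num)⟩, ?_⟩
  intro x hx1 hx2 hxr α β
  have hxε : x.1 + x.2 < ε := hxr.trans_le (min_le_left _ _)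
  have hmem : x ∈ Metric.ball ((0 : ℝ), (0 : ℝ)) ε := by
    rw [Metric.mem_ball, Prod.dist_eq, max_lt_iff]
    simp only [Real.dist_eq, sub_zero, abs_of_pos hx1.1, abs_of_pos hx2.1]
    constructor <;> linarith [hx1.1, hx2.1]
  obtain ⟨d1, d2⟩ := hball ⟨hmem, hx1, hx2⟩
  rw [Real.dist_eq] at d1 d2
  calc _ = |α * (genLog1 b1 s11 s12 s21 s22 x - pd1 b1 (0, 0))
        + β * (genLog2 b2 s11 s12 s21 s22 x - pd2 b2 (0, 0))| := by congr 1; ring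
    _ ≤ |α| * |genLog1 b1 s11 s12 s21 s22 x - pd1 b1 (0, 0)|
        + |β| * |genLog2 b2 s11 s12 s21 s22 x - pd2 b2 (0, 0)| := by
      rw [← abs_mul, ← abs_mul]
      exact abs_add_le _ _
    _ ≤ |α| * (|pd1 b1 (0, 0)| / 2) + |β| * (|pd2 b2 (0, 0)| / 2) := by gcongr
    _ = _ := by ring
end

section
/- Let U ⊆ ℝ² be an open set containing [0,1]², and let b = (b₁, b₂), σ₁ = (σ₁₁, σ₁₂), σ₂ = (σ₂₁, σ₂₂) be twice continuously differentiable vector fields U → ℝ² such that b₂, σ₁₂, σ₂₂ vanish on the bottom edge [0,1] × {0}. For x = (x₁, x₂) ∈ (0,1)² define G₂(x) = b₂(x)/x₂ + (1/2) Σ_{m=1}^{2} [ ∂₁σ_{m 2}(x) σ_{m 1}(x)/x₂ + ∂₂σ_{m 2}(x) σ_{m 2}(x)/x₂ − σ_{m 2}(x)²/x₂² ], and define Λ₂(x) = ∂₂b₂(x) + (1/2)( σ₁₁(x) ∂₁∂₂σ₁₂(x) + σ₂₁(x) ∂₁∂₂σ₂₂(x) ). Then for every ε > 0 there exists δ > 0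 such that for all x ∈ (0,1)² with x₂ < δ one has |G₂(x) − Λ₂(x₁, 0)| < ε. -/
open Set

/-- The mixed partial derivative `∂₁∂₂ f` of a function of two real variables. -/
noncomputable def pd12 (f : ℝ × ℝ → ℝ) (x : ℝ × ℝ) : ℝ := pd1 (pd2 f) x

/-- The function `Λ₂(x) = ∂₂b₂(x) + (1/2)(σ₁₁(x) ∂₁∂₂σ₁₂(x) + σ₂₁(x) ∂₁∂₂σ₂₂(x))`,
whose average against the invariant measure on the bottom edge is the transversal
Lyapunov exponent. -/
noncomputable def transversalRate (b2 s11 s12 s21 s22 : ℝ × ℝ → ℝ) (x : ℝ × ℝ) : ℝ :=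
  pd2 b2 x + (1 / 2) * (s11 x * pd12 s12 x + s21 x * pd12 s22 x)

open Filter Topology

/-- If `g` is strictly differentiable at a point and vanishes on the projections to the axis
`x₂ = 0` of the points of `S`, then the quotient `g(x) / x₂` tends to `∂₂ g` along `S`. -/
lemma tendsto_div_snd {g : ℝ × ℝ → ℝ} {a : ℝ} {S : Set (ℝ × ℝ)}
    (hg : ContDiffAt ℝ 1 g (a, 0)) (hS : ∀ x ∈ S, x.2 ≠ 0)
    (h0 : ∀ x ∈ S, g (x.1, 0) = 0) :
    Tendsto (fun x => g x / x.2) (𝓝[S] (a, 0)) (𝓝 (pd2 g (a, 0))) := by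
  have hstrict := (hg.hasStrictFDerivAt one_ne_zero).isLittleO
  have hpair : Tendsto (fun x : ℝ × ℝ => (x, (x.1, (0 : ℝ)))) (𝓝[S] (a, 0))
      (𝓝 ((a, 0), (a, 0))) := by
    have : Continuous fun x : ℝ × ℝ => (x, (x.1, (0 : ℝ))) := by fun_prop
    exact (this.tendsto (a, 0)).mono_left nhdsWithin_le_nhds
  have ho : (fun x : ℝ × ℝ => g x - x.2 * pd2 g (a, 0)) =o[𝓝[S] (a, 0)] fun x => x.2 := by
    refine ((hstrict.comp_tendsto hpair).congr' ?_ ?_).trans_isBigO (g := fun x => (0, x.2)) ?_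
    · filter_upwards [self_mem_nhdsWithin] with x hx
      have hx2 : x - (x.1, 0) = x.2 • ((0 : ℝ), (1 : ℝ)) := by ext <;> simp
      simp only [Function.comp_apply]
      rw [hx2, map_smul, h0 x hx, sub_zero, smul_eq_mul, pd2]
    · refine Eventually.of_forall fun x => ?_
      ext <;> simp
    · exact Asymptotics.isBigO_of_le _ fun x => by simp [Prod.norm_def]
  have hlim := ho.tendsto_div_nhds_zero.add_const (pd2 g (a, 0))
  rw [zero_add] at hlim
  refine hlim.congr' ?_
  filter_upwards [self_mem_nhdsWithin] with x hx
  have := hS x hx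
  field_simp
  ring

lemma contDiffAt_fderiv_apply {f : ℝ × ℝ → ℝ} {p : ℝ × ℝ} {m n : WithTop ℕ∞}
    (hf : ContDiffAt ℝ n f p) (hmn : m + 1 ≤ n) (v : ℝ × ℝ) :
    ContDiffAt ℝ m (fun x => fderiv ℝ f x v) p :=
  (hf.fderiv_right hmn).clm_apply contDiffAt_const

/-- The mixed second partial derivatives of a `C²` function agree. -/
lemma pd2_pd1_eq_pd12 {f : ℝ × ℝ → ℝ} {p : ℝ × ℝ} (hf : ContDiffAt ℝ 2 f p) :
    pd2 (pd1 f) p = pd12 f p := by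
  have hd : DifferentiableAt ℝ (fderiv ℝ f) p :=
    (hf.fderiv_right (m := 1) (by norm_num)).differentiableAt one_ne_zero
  have happly (v w : ℝ × ℝ) :
      fderiv ℝ (fun x => fderiv ℝ f x v) p w = fderiv ℝ (fderiv ℝ f) p w v := by
    rw [fderiv_clm_apply hd (differentiableAt_const v)]
    simp
  have hsymm : IsSymmSndFDerivAt ℝ f p := hf.isSymmSndFDerivAt (by simp)
  change fderiv ℝ (fun x => fderiv ℝ f x (1, 0)) p (0, 1)
    = fderiv ℝ (fun x => fderiv ℝ f x (0, 1)) p (1, 0)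
  rw [happly, happly, hsymm.eq]

lemma pd1_eq_zero_of_eventually {f : ℝ × ℝ → ℝ} {t : ℝ} (hf : DifferentiableAt ℝ f (t, 0))
    (h0 : ∀ᶠ s in 𝓝 t, f (s, 0) = 0) : pd1 f (t, 0) = 0 := by
  have hline : HasDerivAt (fun s : ℝ => (s, (0 : ℝ))) (1, 0) t :=
    (hasDerivAt_id t).prodMk (hasDerivAt_const t 0)
  exact (hf.hasFDerivAt.comp_hasDerivAt t hline).unique
    ((hasDerivAt_const t (0 : ℝ)).congr_of_eventuallyEq h0)

/-- Contribution of one noise field `(r, s)` to the limit of the generator of `ln ∘ x₂`. -/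
lemma tendsto_noise_term {r s : ℝ × ℝ → ℝ} {a : ℝ} {S : Set (ℝ × ℝ)}
    (hr : ContinuousAt r (a, 0)) (hs : ContDiffAt ℝ 2 s (a, 0)) (hS : ∀ x ∈ S, x.2 ≠ 0)
    (h0 : ∀ x ∈ S, s (x.1, 0) = 0) (h1 : ∀ x ∈ S, pd1 s (x.1, 0) = 0) :
    Tendsto (fun x => pd1 s x * r x / x.2 + pd2 s x * s x / x.2 - s x ^ 2 / x.2 ^ 2)
      (𝓝[S] (a, 0)) (𝓝 (r (a, 0) * pd12 s (a, 0))) := by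
  have hdiv := tendsto_div_snd (hs.of_le (by norm_num)) hS h0
  have hdiv1 := tendsto_div_snd (g := pd1 s)
    (contDiffAt_fderiv_apply hs (by norm_num) (1, 0)) hS h1
  rw [pd2_pd1_eq_pd12 hs] at hdiv1
  have hpd2 : ContinuousAt (pd2 s) (a, 0) :=
    (contDiffAt_fderiv_apply hs (m := 1) (by norm_num) (0, 1)).continuousAt
  have hlim := (((hr.tendsto.mono_left nhdsWithin_le_nhds).mul hdiv1).add
    ((hpd2.tendsto.mono_left nhdsWithin_le_nhds).mul hdiv)).sub (hdiv.pow 2)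
  rw [show r (a, 0) * pd12 s (a, 0) + pd2 s (a, 0) * pd2 s (a, 0) - pd2 s (a, 0) ^ 2
    = r (a, 0) * pd12 s (a, 0) by ring] at hlim
  refine hlim.congr fun x => ?_
  ring

lemma continuousAt_transversalRate {b2 s11 s12 s21 s22 : ℝ × ℝ → ℝ} {p : ℝ × ℝ}
    (hb2 : ContDiffAt ℝ 2 b2 p) (hs11 : ContinuousAt s11 p) (hs12 : ContDiffAt ℝ 2 s12 p)
    (hs21 : ContinuousAt s21 p) (hs22 : ContDiffAt ℝ 2 s22 p) :
    ContinuousAt (transversalRate b2 s11 s12 s21 s22) p := by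
  have hpd2 : ContinuousAt (pd2 b2) p :=
    (contDiffAt_fderiv_apply hb2 (m := 1) (by norm_num) (0, 1)).continuousAt
  have hpd12 {s : ℝ × ℝ → ℝ} (hs : ContDiffAt ℝ 2 s p) : ContinuousAt (pd12 s) p :=
    (contDiffAt_fderiv_apply (m := 0)
      (contDiffAt_fderiv_apply hs (m := 1) (by norm_num) (0, 1)) (by norm_num)
      (1, 0)).continuousAt
  exact hpd2.add (continuousAt_const.mul ((hs11.mul (hpd12 hs12)).add (hs21.mul (hpd12 hs22))))

/-- Lemma 4.3 of the paper: under the smoothness assumptions and the invariance of the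
bottom edge, the generator applied to `ln ∘ x₂` converges to `Λ₂(x₁, 0)` as `x₂ → 0`,
uniformly in `x₁`. -/
theorem generator_log_near_edge
    (U : Set (ℝ × ℝ)) (hU : IsOpen U)
    (hsq : Set.Icc ((0 : ℝ), (0 : ℝ)) (1, 1) ⊆ U)
    (b1 b2 s11 s12 s21 s22 : ℝ × ℝ → ℝ)
    (hb1 : ContDiffOn ℝ 2 b1 U) (hb2 : ContDiffOn ℝ 2 b2 U)
    (hs11 : ContDiffOn ℝ 2 s11 U) (hs12 : ContDiffOn ℝ 2 s12 U)
    (hs21 : ContDiffOn ℝ 2 s21 U) (hs22 : ContDiffOn ℝ 2 s22 U)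
    (hbot : ∀ x₁ ∈ Set.Icc (0 : ℝ) 1,
      b2 (x₁, 0) = 0 ∧ s12 (x₁, 0) = 0 ∧ s22 (x₁, 0) = 0) :
    ∀ ε > (0 : ℝ), ∃ δ > (0 : ℝ), ∀ x : ℝ × ℝ,
      x.1 ∈ Set.Ioo (0 : ℝ) 1 → x.2 ∈ Set.Ioo (0 : ℝ) 1 → x.2 < δ →
      |genLog2 b2 s11 s12 s21 s22 x - transversalRate b2 s11 s12 s21 s22 (x.1, 0)| < ε := by
  intro ε hε
  let S : Set (ℝ × ℝ) := Ioo 0 1 ×ˢ Ioi 0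
  have hS : ∀ x ∈ S, x.2 ≠ 0 := fun x hx => ne_of_gt hx.2
  have hmemU {a : ℝ} (ha : a ∈ Icc (0 : ℝ) 1) : U ∈ 𝓝 (a, (0 : ℝ)) :=
    hU.mem_nhds (hsq ⟨⟨ha.1, le_rfl⟩, ⟨ha.2, zero_le_one⟩⟩)
  have hpd1 {s : ℝ × ℝ → ℝ} (hs : ContDiffOn ℝ 2 s U)
      (h0 : ∀ t ∈ Icc (0 : ℝ) 1, s (t, 0) = 0) : ∀ x ∈ S, pd1 s (x.1, 0) = 0 := by
    intro x hx
    refine pd1_eq_zero_of_eventually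
      ((hs.contDiffAt (hmemU (Ioo_subset_Icc_self hx.1))).differentiableAt two_ne_zero) ?_
    filter_upwards [Icc_mem_nhds hx.1.1 hx.1.2] with t ht using h0 t ht
  have hlocal : ∀ p ∈ Icc (0 : ℝ) 1 ×ˢ {(0 : ℝ)}, {x | x ∈ S →
      |genLog2 b2 s11 s12 s21 s22 x - transversalRate b2 s11 s12 s21 s22 (x.1, 0)| < ε}
        ∈ 𝓝 p := by
    rintro ⟨a, c⟩ ⟨ha, rfl⟩
    have hUa := hmemU ha
    have hedge {x : ℝ × ℝ} (hx : x ∈ S) := hbot x.1 (Ioo_subset_Icc_self hx.1)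
    have hgen : Tendsto (genLog2 b2 s11 s12 s21 s22) (𝓝[S] (a, 0))
        (𝓝 (transversalRate b2 s11 s12 s21 s22 (a, 0))) :=
      (tendsto_div_snd ((hb2.contDiffAt hUa).of_le (by norm_num)) hS
        fun x hx => (hedge hx).1).add
      (((tendsto_noise_term (hs11.contDiffAt hUa).continuousAt (hs12.contDiffAt hUa) hS
          (fun x hx => (hedge hx).2.1) (hpd1 hs12 fun t ht => (hbot t ht).2.1)).add
        (tendsto_noise_term (hs21.contDiffAt hUa).continuousAt (hs22.contDiffAt hUa) hS
          (fun x hx => (hedge hx).2.2) (hpd1 hs22 fun t ht => (hbot t ht).2.2))).const_mul _)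
    have hproj : Tendsto (fun x : ℝ × ℝ => (x.1, (0 : ℝ))) (𝓝[S] (a, 0)) (𝓝 (a, 0)) := by
      have : Continuous fun x : ℝ × ℝ => (x.1, (0 : ℝ)) := by fun_prop
      exact (this.tendsto (a, 0)).mono_left nhdsWithin_le_nhds
    have hrate := (continuousAt_transversalRate (hb2.contDiffAt hUa)
      (hs11.contDiffAt hUa).continuousAt (hs12.contDiffAt hUa)
      (hs21.contDiffAt hUa).continuousAt (hs22.contDiffAt hUa)).tendsto.comp hproj
    have hdiff := (hgen.sub hrate).abs
    rw [sub_self, abs_zero] at hdiff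
    exact eventually_nhdsWithin_iff.mp (hdiff.eventually (gt_mem_nhds hε))
  obtain ⟨δ, hδ, hsub⟩ :=
    (Metric.hasBasis_nhdsSet_thickening (isCompact_Icc.prod isCompact_singleton)).mem_iff.mp
      (mem_nhdsSet_iff_forall.mpr hlocal)
  refine ⟨δ, hδ, fun x hx1 hx2 hxδ => hsub ?_ ⟨hx1, hx2.1⟩⟩
  refine Metric.mem_thickening_iff.mpr ⟨(x.1, 0), ⟨Ioo_subset_Icc_self hx1, rfl⟩, ?_⟩
  simpa [Prod.dist_eq, Real.dist_eq, abs_of_pos hx2.1, hδ] using hxδ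
end
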